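/- Let Z be a random vector in ℝ^d that is multivariate regularly varying with index α > 0 and limit measure μ, and let M be a random q×d matrix independent of Z with E[‖M‖^γ] < ∞ for some γ > α. Define μ̃(·) := E[μ(M^{-1}(·))] (the expected pushforward of μ under M, with M^{-1} the preimage), and suppose μ̃({x ∈ ℝ^q : ‖x‖ > 1}) > 0. Then M·Z is multivariate regularly varying with index α and limit measure μ*(·) = μ̃(·)/μ̃({‖x‖ > 1}); in particular, for every Borel set M₀ ⊆ ℝ^q bounded away from 0 with μ*(∂M₀) = 0, lim_{t→∞} P(M·Z ∈ tM₀)/P(‖M·Z‖ > t) = μ*(M₀). -/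

import Mathlib

open MeasureTheory ProbabilityTheory Filter Set Pointwise

/-- A set is bounded away from the origin. -/
def BddAwayFromZero {d : ℕ} (S : Set (Fin d → ℝ)) : Prop :=
  ∃ ε > 0, ∀ x ∈ S, ε ≤ ‖x‖

/-- Multivariate regular variation of a random vector `Z` with index `α` and limit
set-function `ν`: `ν` is non-null, finite on sets bounded away from `0`,
`P(Z ∈ tS)/P(‖Z‖ > t) → ν(S)` for `ν`-continuity sets, and `ν(tS) = t^{-α} ν(S)`. -/
def IsMRV {Ω : Type*} [MeasurableSpace Ω] (P : Measure Ω) {d : ℕ}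
    (Z : Ω → Fin d → ℝ) (α : ℝ) (ν : Set (Fin d → ℝ) → ENNReal) : Prop :=
  (∃ S : Set (Fin d → ℝ), MeasurableSet S ∧ BddAwayFromZero S ∧ ν S ≠ 0) ∧
  (∀ S : Set (Fin d → ℝ), MeasurableSet S → BddAwayFromZero S → ν S < ⊤) ∧
  (∀ S : Set (Fin d → ℝ), MeasurableSet S → BddAwayFromZero S → ν (frontier S) = 0 →
    Tendsto (fun t : ℝ =>
        (P {ω | Z ω ∈ t • S}).toReal / (P {ω | t < ‖Z ω‖}).toReal)
      atTop (nhds (ν S).toReal)) ∧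
  (∀ t : ℝ, 0 < t → ∀ S : Set (Fin d → ℝ), MeasurableSet S → BddAwayFromZero S →
    ν (t • S) = ENNReal.ofReal (t ^ (-α)) * ν S)

/-- The linear action of a `q × d` matrix on a vector. -/
def matApply {q d : ℕ} (m : Fin q → Fin d → ℝ) (x : Fin d → ℝ) : Fin q → ℝ :=
  fun i => ∑ j, m i j * x j

theorem smul_setOf_lt_norm {d : ℕ} {t : ℝ} (ht : 0 < t) (r : ℝ) :
    t • {x : Fin d → ℝ | r < ‖x‖} = {x | t * r < ‖x‖} := by
  ext x
  rw [mem_smul_set_iff_inv_smul_mem₀ ht.ne']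
  simp only [mem_ofPred_eq, norm_smul, norm_inv, Real.norm_of_nonneg ht.le]
  rw [lt_inv_mul_iff₀ ht]

theorem smul_setOf_norm_eq {d : ℕ} {t : ℝ} (ht : 0 < t) (r : ℝ) :
    t • {x : Fin d → ℝ | ‖x‖ = r} = {x | ‖x‖ = t * r} := by
  ext x
  rw [mem_smul_set_iff_inv_smul_mem₀ ht.ne']
  simp only [mem_ofPred_eq, norm_smul, norm_inv, Real.norm_of_nonneg ht.le]
  rw [inv_mul_eq_iff_eq_mul₀ ht.ne']

theorem measurableSet_lt_norm {d : ℕ} (r : ℝ) : MeasurableSet {x : Fin d → ℝ | r < ‖x‖} :=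
  measurableSet_lt measurable_const measurable_norm

theorem measurableSet_norm_eq {d : ℕ} (r : ℝ) : MeasurableSet {x : Fin d → ℝ | ‖x‖ = r} :=
  measurableSet_eq_fun measurable_norm measurable_const

theorem bddAwayFromZero_lt_norm {d : ℕ} {r : ℝ} (hr : 0 < r) :
    BddAwayFromZero {x : Fin d → ℝ | r < ‖x‖} :=
  ⟨r, hr, fun _ hx => le_of_lt hx⟩

theorem bddAwayFromZero_norm_eq {d : ℕ} {r : ℝ} (hr : 0 < r) :
    BddAwayFromZero {x : Fin d → ℝ | ‖x‖ = r} :=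
  ⟨r, hr, fun _ hx => ge_of_eq hx⟩

theorem BddAwayFromZero.smul {d : ℕ} {S : Set (Fin d → ℝ)} (hS : BddAwayFromZero S) {t : ℝ}
    (ht : 0 < t) : BddAwayFromZero (t • S) := by
  obtain ⟨ε, hε, h⟩ := hS
  refine ⟨t * ε, by positivity, ?_⟩
  rintro _ ⟨x, hx, rfl⟩
  simp only [norm_smul, Real.norm_of_nonneg ht.le]
  exact mul_le_mul_of_nonneg_left (h x hx) ht.le

theorem BddAwayFromZero.closure {d : ℕ} {S : Set (Fin d → ℝ)} (hS : BddAwayFromZero S) :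
    BddAwayFromZero (closure S) := by
  obtain ⟨ε, hε, h⟩ := hS
  exact ⟨ε, hε, closure_minimal h (isClosed_le continuous_const continuous_norm)⟩

theorem BddAwayFromZero.frontier {d : ℕ} {S : Set (Fin d → ℝ)} (hS : BddAwayFromZero S) :
    BddAwayFromZero (frontier S) := by
  obtain ⟨ε, hε, h⟩ := hS.closure
  exact ⟨ε, hε, fun x hx => h x (frontier_subset_closure hx)⟩

/-- A homogeneous measure, finite away from the origin, does not charge spheres. -/
theorem measure_sphere_eq_zero {d : ℕ} {ν : Measure (Fin d → ℝ)} {α : ℝ}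
    (hfin : ∀ S : Set (Fin d → ℝ), MeasurableSet S → BddAwayFromZero S → ν S < ⊤)
    (hhom : ∀ t : ℝ, 0 < t → ∀ S : Set (Fin d → ℝ), MeasurableSet S → BddAwayFromZero S →
      ν (t • S) = ENNReal.ofReal (t ^ (-α)) * ν S) {r : ℝ} (hr : 0 < r) :
    ν {x | ‖x‖ = r} = 0 := by
  by_contra hne
  have hU : MeasurableSet {x : Fin d → ℝ | r / 2 < ‖x‖} := measurableSet_lt_norm _
  have : IsFiniteMeasure (ν.restrict {x | r / 2 < ‖x‖}) :=
    ⟨by simpa using hfin _ hU (bddAwayFromZero_lt_norm (half_pos hr))⟩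
  have hc := Measure.countable_meas_level_set_pos (μ := ν.restrict {x | r / 2 < ‖x‖})
    (g := fun x : Fin d → ℝ => ‖x‖) measurable_norm
  refine (Cardinal.Real.Ioo_countable_iff (x := r) (y := 2 * r)).not.2 (by linarith)
    (hc.mono fun t ht => ?_)
  have ht0 : 0 < t := hr.trans ht.1
  simp only [mem_ofPred_eq]
  rw [Measure.restrict_apply (measurableSet_norm_eq t), inter_eq_left.2, pos_iff_ne_zero]
  · have h := hhom (t / r) (by positivity) _ (measurableSet_norm_eq r) (bddAwayFromZero_norm_eq hr)
    rw [smul_setOf_norm_eq (by positivity), div_mul_cancel₀ _ hr.ne'] at h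
    rw [h]
    refine mul_ne_zero ?_ hne
    rw [ne_eq, ENNReal.ofReal_eq_zero, not_le]
    positivity
  · rintro x rfl
    have := ht.1
    simp only [mem_ofPred_eq]
    linarith

/-- The frontier of the complement of a ball is a null set for a homogeneous measure. -/
theorem measure_frontier_lt_norm {d : ℕ} {ν : Measure (Fin d → ℝ)} {α : ℝ}
    (hfin : ∀ S : Set (Fin d → ℝ), MeasurableSet S → BddAwayFromZero S → ν S < ⊤)
    (hhom : ∀ t : ℝ, 0 < t → ∀ S : Set (Fin d → ℝ), MeasurableSet S → BddAwayFromZero S →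
      ν (t • S) = ENNReal.ofReal (t ^ (-α)) * ν S) {r : ℝ} (hr : 0 < r) :
    ν (frontier {x | r < ‖x‖}) = 0 :=
  measure_mono_null (fun _ hx => (frontier_lt_subset_eq continuous_const continuous_norm hx).symm)
    (measure_sphere_eq_zero hfin hhom hr)

section Tail

theorem setOf_mem_smul_lt_norm {Ω : Type*} {d : ℕ} {Z : Ω → Fin d → ℝ} {t : ℝ} (ht : 0 < t) (r : ℝ) :
    {ω | Z ω ∈ t • {x : Fin d → ℝ | r < ‖x‖}} = {ω | t * r < ‖Z ω‖} := by
  rw [smul_setOf_lt_norm ht]; rfl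

variable {Ω : Type*} [MeasurableSpace Ω] {P : Measure Ω} {d : ℕ} {Z : Ω → Fin d → ℝ} {α : ℝ}
  {μ : Measure (Fin d → ℝ)}

theorem IsMRV.tendsto_tail_ratio (h : IsMRV P Z α (fun S => μ S)) {r : ℝ} (hr : 0 < r) :
    Tendsto (fun t : ℝ => P.real {ω | t * r < ‖Z ω‖} / P.real {ω | t < ‖Z ω‖})
      atTop (nhds (μ {x | r < ‖x‖}).toReal) := by
  obtain ⟨-, hfin, hlim, hhom⟩ := h
  refine (hlim _ (measurableSet_lt_norm r) (bddAwayFromZero_lt_norm hr)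
    (measure_frontier_lt_norm hfin hhom hr)).congr' ?_
  filter_upwards [eventually_gt_atTop 0] with t ht
  rw [setOf_mem_smul_lt_norm ht]
  rfl

theorem IsMRV.measure_lt_norm (h : IsMRV P Z α (fun S => μ S)) {r : ℝ} (hr : 0 < r) :
    μ {x | r < ‖x‖} = ENNReal.ofReal (r ^ (-α)) * μ {x | 1 < ‖x‖} := by
  rw [← h.2.2.2 r hr _ (measurableSet_lt_norm 1) (bddAwayFromZero_lt_norm one_pos),
    smul_setOf_lt_norm hr, mul_one]

variable [IsProbabilityMeasure P]

theorem IsMRV.tail_pos (h : IsMRV P Z α (fun S => μ S)) (t : ℝ) :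
    0 < P.real {ω | t < ‖Z ω‖} := by
  refine measureReal_nonneg.lt_of_ne' fun h0 => ?_
  have hev : ∀ᶠ s : ℝ in atTop,
      0 = P.real {ω | s * 1 < ‖Z ω‖} / P.real {ω | s < ‖Z ω‖} := by
    filter_upwards [eventually_ge_atTop t] with s hs
    have : P.real {ω | s < ‖Z ω‖} = 0 := le_antisymm
      ((measureReal_mono fun ω (hω : s < ‖Z ω‖) => hs.trans_lt hω).trans_eq h0)
      measureReal_nonneg
    rw [this, div_zero]
  have h1 := tendsto_nhds_unique (h.tendsto_tail_ratio one_pos)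
    (tendsto_const_nhds.congr' hev)
  rw [ENNReal.toReal_eq_zero_iff, or_iff_left
    (h.2.1 _ (measurableSet_lt_norm 1) (bddAwayFromZero_lt_norm one_pos)).ne] at h1
  obtain ⟨S, -, ⟨ε, hε, hS⟩, hne⟩ := h.1
  refine hne (measure_mono_null (fun x hx => ?_)
    ((h.measure_lt_norm (half_pos hε)).trans (by rw [h1, mul_zero])))
  exact (half_lt_self hε).trans_le (hS x hx)

theorem IsMRV.measure_one_lt_norm (h : IsMRV P Z α (fun S => μ S)) :
    μ {x | 1 < ‖x‖} = 1 := by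
  have h1 := h.tendsto_tail_ratio one_pos
  simp only [mul_one, div_self (h.tail_pos _).ne'] at h1
  exact (ENNReal.toReal_eq_one_iff _).1 (tendsto_nhds_unique h1 tendsto_const_nhds)

/-- A Potter-type bound for the tail of the norm. -/
theorem IsMRV.exists_potter_bound (h : IsMRV P Z α (fun S => μ S)) {γ : ℝ} (hα : 0 < α)
    (hγ : α < γ) : ∃ C t₀ : ℝ, 0 ≤ C ∧ 0 < t₀ ∧ ∀ t ≥ t₀, ∀ a > 0,
      P.real {ω | t / a < ‖Z ω‖} / P.real {ω | t < ‖Z ω‖} ≤ 1 + C * a ^ γ := by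
  set G : ℝ → ℝ := fun t => P.real {ω | t < ‖Z ω‖} with hG
  have hGpos : ∀ t, 0 < G t := h.tail_pos
  have hanti : Antitone G := fun s t hst =>
    measureReal_mono fun ω (hω : t < ‖Z ω‖) => hst.trans_lt hω
  have hG1 : ∀ t, G t ≤ 1 := fun t => measureReal_le_one
  have hγ0 : 0 < γ := hα.trans hγ
  have hlim := h.tendsto_tail_ratio two_pos
  rw [h.measure_lt_norm two_pos, h.measure_one_lt_norm, mul_one,
    ENNReal.toReal_ofReal (by positivity)] at hlim
  have hlt : (2 : ℝ) ^ (-γ) < 2 ^ (-α) :=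
    Real.rpow_lt_rpow_of_exponent_lt one_lt_two (neg_lt_neg hγ)
  obtain ⟨t₁, ht₁⟩ := eventually_atTop.1 (hlim.eventually_const_lt hlt)
  obtain ⟨t₀, ht₀, ht₀pos⟩ : ∃ t₀, t₁ ≤ t₀ ∧ 0 < t₀ :=
    ⟨max t₁ 1, le_max_left _ _, by positivity⟩
  have hstep : ∀ t ≥ t₀, G t ≤ 2 ^ γ * G (t * 2) := fun t ht => by
    have := ht₁ t (ht₀.trans ht)
    rw [lt_div_iff₀ (hGpos t), Real.rpow_neg two_pos.le, inv_mul_lt_iff₀ (by positivity)] at this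
    exact this.le
  have hiter : ∀ n : ℕ, ∀ t ≥ t₀, G t ≤ ((2 : ℝ) ^ n) ^ γ * G (t * 2 ^ n) := by
    intro n
    induction n with
    | zero => intro t _; simp
    | succ n ih =>
      intro t ht
      have h2 : t₀ ≤ t * 2 ^ n :=
        ht.le.trans (le_mul_of_one_le_right (ht₀pos.le.trans ht) (one_le_pow₀ one_le_two))
      calc G t ≤ ((2 : ℝ) ^ n) ^ γ * G (t * 2 ^ n) := ih t ht
        _ ≤ ((2 : ℝ) ^ n) ^ γ * (2 ^ γ * G (t * 2 ^ n * 2)) := by gcongr; exact hstep _ h2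
        _ = ((2 : ℝ) ^ (n + 1)) ^ γ * G (t * 2 ^ (n + 1)) := by
          rw [pow_succ, Real.mul_rpow (by positivity) two_pos.le, mul_assoc t, mul_assoc]
  have hpot : ∀ s ≥ t₀, ∀ b ≥ 1, G s ≤ (2 * b) ^ γ * G (s * b) := by
    intro s hs b hb
    obtain ⟨n, hn1, hn2⟩ := exists_nat_pow_near hb one_lt_two
    have hs0 : 0 < s := ht₀pos.trans_le hs
    calc G s ≤ ((2 : ℝ) ^ (n + 1)) ^ γ * G (s * 2 ^ (n + 1)) := hiter _ s hs
      _ ≤ (2 * b) ^ γ * G (s * b) := by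
        gcongr
        · rw [pow_succ']; gcongr
        · exact hanti (by gcongr)
  refine ⟨2 ^ γ / G t₀, t₀, div_nonneg (by positivity) (hGpos _).le, ht₀pos, fun t ht a ha => ?_⟩
  have ht0 : 0 < t := ht₀pos.trans_le ht
  change G (t / a) / G t ≤ _
  have hCa : 0 ≤ 2 ^ γ / G t₀ * a ^ γ :=
    mul_nonneg (div_nonneg (by positivity) (hGpos _).le) (by positivity)
  rcases le_total a 1 with ha1 | ha1
  · have : G (t / a) / G t ≤ 1 := (div_le_one (hGpos t)).2 (hanti (le_div_self ht0.le ha ha1))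
    linarith
  refine le_add_of_nonneg_of_le zero_le_one ?_
  rw [div_mul_eq_mul_div, ← Real.mul_rpow two_pos.le ha.le, div_le_div_iff₀ (hGpos _) (hGpos _)]
  rcases le_total t₀ (t / a) with hs | hs
  · calc G (t / a) * G t₀ ≤ G (t / a) * 1 := by gcongr; exact hG1 _
      _ ≤ (2 * a) ^ γ * G t := by
        have := hpot _ hs a ha1
        rwa [div_mul_cancel₀ _ ha.ne', ← mul_one (G (t / a))] at this
  · have h1 : 1 ≤ t / t₀ := (one_le_div ht₀pos).2 ht
    have h2 : t / t₀ ≤ a := by rwa [div_le_comm₀ ht₀pos ha]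
    calc G (t / a) * G t₀ ≤ 1 * G t₀ := by gcongr; exact hG1 _
      _ ≤ (2 * (t / t₀)) ^ γ * G t := by
        have := hpot _ le_rfl _ h1
        rwa [mul_div_cancel₀ _ ht₀pos.ne', ← one_mul (G t₀)] at this
      _ ≤ (2 * a) ^ γ * G t := by gcongr

end Tail

section MatApply

variable {q d : ℕ}

theorem continuous_matApply :
    Continuous fun p : (Fin q → Fin d → ℝ) × (Fin d → ℝ) => matApply p.1 p.2 := by
  unfold matApply
  fun_prop

theorem continuous_matApply_right (m : Fin q → Fin d → ℝ) : Continuous (matApply m) :=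
  continuous_matApply.comp (Continuous.prodMk_right m)

theorem matApply_smul (m : Fin q → Fin d → ℝ) (t : ℝ) (x : Fin d → ℝ) :
    matApply m (t • x) = t • matApply m x := by
  ext i
  simp only [matApply, Pi.smul_apply, smul_eq_mul, Finset.mul_sum]
  exact Finset.sum_congr rfl fun j _ => mul_left_comm _ _ _

theorem norm_matApply_le (m : Fin q → Fin d → ℝ) (x : Fin d → ℝ) :
    ‖matApply m x‖ ≤ d * ‖m‖ * ‖x‖ := by
  refine (pi_norm_le_iff_of_nonneg (by positivity)).2 fun i => (norm_sum_le _ _).trans ?_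
  calc ∑ j, ‖m i j * x j‖ ≤ ∑ _j : Fin d, ‖m‖ * ‖x‖ := by
        refine Finset.sum_le_sum fun j _ => ?_
        rw [norm_mul]
        gcongr
        · exact (norm_le_pi_norm (m i) j).trans (norm_le_pi_norm m i)
        · exact norm_le_pi_norm x j
    _ = d * ‖m‖ * ‖x‖ := by simp [mul_assoc]

theorem preimage_matApply_smul (m : Fin q → Fin d → ℝ) {t : ℝ} (ht : 0 < t)
    (S : Set (Fin q → ℝ)) : matApply m ⁻¹' (t • S) = t • matApply m ⁻¹' S := by
  ext x
  rw [mem_smul_set_iff_inv_smul_mem₀ ht.ne', mem_preimage, mem_preimage, matApply_smul,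
    mem_smul_set_iff_inv_smul_mem₀ ht.ne']

theorem preimage_matApply_subset (m : Fin q → Fin d → ℝ) {ε : ℝ} (hε : 0 < ε)
    {S : Set (Fin q → ℝ)} (hS : ∀ x ∈ S, ε ≤ ‖x‖) :
    matApply m ⁻¹' S ⊆ {x | 1 / (2 * (d * ‖m‖ + 1) / ε) < ‖x‖} := by
  intro x hx
  have h1 := (hS _ hx).trans (norm_matApply_le m x)
  have hA : 0 ≤ (d : ℝ) * ‖m‖ := by positivity
  have hx0 : 0 < ‖x‖ := pos_of_mul_pos_right (hε.trans_le h1) hA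
  rw [mem_ofPred_eq, one_div_div, div_lt_iff₀ (by positivity)]
  nlinarith

theorem BddAwayFromZero.preimage_matApply (m : Fin q → Fin d → ℝ) {S : Set (Fin q → ℝ)}
    (hS : BddAwayFromZero S) : BddAwayFromZero (matApply m ⁻¹' S) := by
  obtain ⟨ε, hε, h⟩ := hS
  exact ⟨_, by positivity, fun x hx => (preimage_matApply_subset m hε h hx).le⟩

theorem integrable_rpow_affine_norm {Ω : Type*} [MeasurableSpace Ω] {P : Measure Ω}
    [IsFiniteMeasure P] {M : Ω → Fin q → Fin d → ℝ} (hM : Measurable M) {γ : ℝ} (hγ : 0 < γ)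
    (hint : Integrable (fun ω => ‖M ω‖ ^ γ) P) {ε : ℝ} (hε : 0 < ε) :
    Integrable (fun ω => (2 * (d * ‖M ω‖ + 1) / ε) ^ γ) P := by
  refine Integrable.mono' ((hint.add (integrable_const 1)).const_mul
    ((2 * (d + 1) / ε) ^ γ)) (Measurable.pow_const (by fun_prop) γ).aestronglyMeasurable
    (ae_of_all _ fun ω => ?_)
  rw [Real.norm_of_nonneg (by positivity)]
  have hx : 0 ≤ ‖M ω‖ := norm_nonneg _
  simp only [Pi.add_apply]
  calc (2 * (d * ‖M ω‖ + 1) / ε) ^ γ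
      ≤ (2 * (d + 1) / ε * max ‖M ω‖ 1) ^ γ := by
        rw [div_mul_eq_mul_div, mul_assoc, add_mul, one_mul]
        gcongr
        exacts [le_max_left _ _, le_max_right _ _]
    _ = (2 * (d + 1) / ε) ^ γ * (max ‖M ω‖ 1) ^ γ :=
        Real.mul_rpow (by positivity) (by positivity)
    _ ≤ (2 * (d + 1) / ε) ^ γ * (‖M ω‖ ^ γ + 1) := by
        gcongr
        rcases max_cases ‖M ω‖ 1 with ⟨h, -⟩ | ⟨h, -⟩ <;> rw [h]
        · linarith
        · rw [Real.one_rpow]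
          exact le_add_of_nonneg_left (by positivity)

end MatApply

theorem sigmaFinite_restrict_compl_zero {d : ℕ} {μ : Measure (Fin d → ℝ)}
    (hfin : ∀ S : Set (Fin d → ℝ), MeasurableSet S → BddAwayFromZero S → μ S < ⊤) :
    SigmaFinite (μ.restrict {0}ᶜ) := by
  refine ⟨⟨⟨fun n : ℕ => {x | 1 / ((n : ℝ) + 1) < ‖x‖} ∪ {0}, fun _ => trivial,
    fun n => ?_, ?_⟩⟩⟩
  · have hn : 0 < 1 / ((n : ℝ) + 1) := by positivity
    refine (measure_union_le _ _).trans_lt (ENNReal.add_lt_top.2 ⟨?_, ?_⟩)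
    · exact (Measure.restrict_apply_le _ _).trans_lt
        (hfin _ (measurableSet_lt_norm _) (bddAwayFromZero_lt_norm hn))
    · rw [Measure.restrict_apply (measurableSet_singleton 0)]
      simp
  · refine eq_univ_of_forall fun x => mem_iUnion.2 ?_
    rcases eq_or_ne x 0 with rfl | hx
    · exact ⟨0, Or.inr rfl⟩
    · obtain ⟨n, hn⟩ := exists_nat_one_div_lt (norm_pos_iff.2 hx)
      exact ⟨n, Or.inl hn⟩

/-- The mixture `E[μ(M⁻¹ ·)]` of the images of `μ`, with the mass of `μ` at the origin removed. -/
noncomputable def mixMeasure {Ω : Type*} [MeasurableSpace Ω] (P : Measure Ω) {q d : ℕ}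
    (M : Ω → Fin q → Fin d → ℝ) (μ : Measure (Fin d → ℝ)) : Measure (Fin q → ℝ) :=
  (P.prod (μ.restrict {0}ᶜ)).map fun p => matApply (M p.1) p.2

section Mixing

variable {Ω : Type*} [MeasurableSpace Ω] {P : Measure Ω} {q d : ℕ} {Z : Ω → Fin d → ℝ}
  {M : Ω → Fin q → Fin d → ℝ} {α : ℝ} {μ : Measure (Fin d → ℝ)}

theorem restrict_compl_zero_preimage_matApply (m : Fin q → Fin d → ℝ) {S : Set (Fin q → ℝ)}
    (hb : BddAwayFromZero S) :
    μ.restrict {0}ᶜ (matApply m ⁻¹' S) = μ (matApply m ⁻¹' S) := by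
  obtain ⟨ε, hε, h⟩ := hb.preimage_matApply m
  refine Measure.restrict_eq_self _ fun x hx hx0 => ?_
  rw [mem_singleton_iff] at hx0
  have := h x hx
  rw [hx0, norm_zero] at this
  linarith

theorem measurable_measure_preimage_matApply (hM : Measurable M) [SFinite (μ.restrict {0}ᶜ)]
    {S : Set (Fin q → ℝ)} (hS : MeasurableSet S) (hb : BddAwayFromZero S) :
    Measurable fun ω => μ (matApply (M ω) ⁻¹' S) := by
  have hF : Measurable fun p : Ω × (Fin d → ℝ) => matApply (M p.1) p.2 :=
    continuous_matApply.measurable.comp ((hM.comp measurable_fst).prodMk measurable_snd)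
  rw [← funext fun ω => restrict_compl_zero_preimage_matApply (M ω) hb]
  exact measurable_measure_prodMk_left (hF hS)

theorem mixMeasure_apply (hM : Measurable M) [SFinite (μ.restrict {0}ᶜ)]
    {S : Set (Fin q → ℝ)} (hS : MeasurableSet S) (hb : BddAwayFromZero S) :
    mixMeasure P M μ S = ∫⁻ ω, μ (matApply (M ω) ⁻¹' S) ∂P := by
  have hF : Measurable fun p : Ω × (Fin d → ℝ) => matApply (M p.1) p.2 :=
    continuous_matApply.measurable.comp ((hM.comp measurable_fst).prodMk measurable_snd)
  rw [mixMeasure, Measure.map_apply hF hS, Measure.prod_apply (hF hS)]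
  exact lintegral_congr fun ω => restrict_compl_zero_preimage_matApply (M ω) hb

theorem IsMRV.mixMeasure_smul (h : IsMRV P Z α (fun S => μ S)) (hM : Measurable M) {t : ℝ}
    (ht : 0 < t) {S : Set (Fin q → ℝ)} (hS : MeasurableSet S) (hb : BddAwayFromZero S) :
    mixMeasure P M μ (t • S) = ENNReal.ofReal (t ^ (-α)) * mixMeasure P M μ S := by
  have := sigmaFinite_restrict_compl_zero h.2.1
  rw [mixMeasure_apply hM (hS.const_smul₀ t) (hb.smul ht), mixMeasure_apply hM hS hb,
    ← lintegral_const_mul' _ _ ENNReal.ofReal_ne_top]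
  refine lintegral_congr fun ω => ?_
  exact (congrArg μ (preimage_matApply_smul (M ω) ht S)).trans
    (h.2.2.2 t ht _ ((continuous_matApply_right _).measurable hS) (hb.preimage_matApply _))

theorem measure_map_preimage_matApply (hZ : Measurable Z) (m : Fin q → Fin d → ℝ)
    {S : Set (Fin q → ℝ)} (hS : MeasurableSet S) :
    P.map Z (matApply m ⁻¹' S) = P {ω | Z ω ∈ matApply m ⁻¹' S} :=
  Measure.map_apply hZ ((continuous_matApply_right m).measurable hS)

variable [IsProbabilityMeasure P]

theorem IsMRV.measure_preimage_matApply_le (h : IsMRV P Z α (fun S => μ S))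
    (m : Fin q → Fin d → ℝ) {ε : ℝ} (hε : 0 < ε) {S : Set (Fin q → ℝ)}
    (hS : ∀ x ∈ S, ε ≤ ‖x‖) :
    μ (matApply m ⁻¹' S) ≤ ENNReal.ofReal ((2 * (d * ‖m‖ + 1) / ε) ^ α) := by
  refine (measure_mono (preimage_matApply_subset m hε hS)).trans_eq ?_
  rw [h.measure_lt_norm (by positivity), h.measure_one_lt_norm, mul_one, one_div,
    Real.inv_rpow (by positivity), Real.rpow_neg (by positivity), inv_inv]

theorem IsMRV.mixMeasure_lt_top (h : IsMRV P Z α (fun S => μ S)) (hM : Measurable M)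
    (hα : 0 < α) {γ : ℝ} (hγ : α < γ) (hint : Integrable (fun ω => ‖M ω‖ ^ γ) P)
    {S : Set (Fin q → ℝ)} (hS : MeasurableSet S) (hb : BddAwayFromZero S) :
    mixMeasure P M μ S < ⊤ := by
  have := sigmaFinite_restrict_compl_zero h.2.1
  rw [mixMeasure_apply hM hS hb]
  obtain ⟨ε, hε, hb⟩ := hb
  have hI := (integrable_const 1).add (integrable_rpow_affine_norm hM (hα.trans hγ) hint hε)
  refine (lintegral_mono fun ω => ?_).trans_lt hI.lintegral_lt_top
  refine (h.measure_preimage_matApply_le (M ω) hε hb).trans (ENNReal.ofReal_le_ofReal ?_)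
  simp only [Pi.add_apply]
  set a := 2 * (d * ‖M ω‖ + 1) / ε
  have ha : 0 < a := by positivity
  rcases le_total a 1 with h1 | h1
  · have := Real.rpow_le_one ha.le h1 hα.le
    have : 0 ≤ a ^ γ := by positivity
    linarith
  · have := Real.rpow_le_rpow_of_exponent_le h1 hγ.le
    linarith

theorem measurable_measure_map_preimage_matApply (hZ : Measurable Z) {S : Set (Fin q → ℝ)}
    (hS : MeasurableSet S) :
    Measurable fun m : Fin q → Fin d → ℝ => P.map Z (matApply m ⁻¹' S) := by
  have := Measure.isProbabilityMeasure_map (μ := P) hZ.aemeasurable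
  exact measurable_measure_prodMk_left (continuous_matApply.measurable hS)

theorem measurable_measure_mem_preimage_matApply (hZ : Measurable Z) (hM : Measurable M)
    {S : Set (Fin q → ℝ)} (hS : MeasurableSet S) :
    Measurable fun ω => P {ω' | Z ω' ∈ matApply (M ω) ⁻¹' S} := by
  rw [← funext fun ω => measure_map_preimage_matApply hZ (M ω) hS]
  exact (measurable_measure_map_preimage_matApply hZ hS).comp hM

theorem measureReal_matApply_mem_eq_integral (hZ : Measurable Z) (hM : Measurable M)
    (hindep : IndepFun M Z P) {S : Set (Fin q → ℝ)} (hS : MeasurableSet S) :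
    P.real {ω | matApply (M ω) (Z ω) ∈ S} =
      ∫ ω, P.real {ω' | Z ω' ∈ matApply (M ω) ⁻¹' S} ∂P := by
  have hA := continuous_matApply (q := q) (d := d).measurable hS
  have := Measure.isProbabilityMeasure_map (μ := P) hZ.aemeasurable
  have key : P {ω | matApply (M ω) (Z ω) ∈ S} =
      ∫⁻ ω, P {ω' | Z ω' ∈ matApply (M ω) ⁻¹' S} ∂P := by
    calc P {ω | matApply (M ω) (Z ω) ∈ S}
        = P.map (fun ω => (M ω, Z ω))
          ((fun p : (Fin q → Fin d → ℝ) × (Fin d → ℝ) => matApply p.1 p.2) ⁻¹' S) :=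
        (Measure.map_apply (hM.prodMk hZ) hA).symm
      _ = ∫⁻ m, P.map Z (matApply m ⁻¹' S) ∂P.map M := by
        rw [(indepFun_iff_map_prod_eq_prod_map_map hM.aemeasurable hZ.aemeasurable).1 hindep,
          Measure.prod_apply hA]
        rfl
      _ = ∫⁻ ω, P {ω' | Z ω' ∈ matApply (M ω) ⁻¹' S} ∂P := by
        rw [lintegral_map (measurable_measure_map_preimage_matApply hZ hS) hM]
        exact lintegral_congr fun ω => measure_map_preimage_matApply hZ (M ω) hS
  rw [Measure.real, key, ← integral_toReal
    (measurable_measure_mem_preimage_matApply hZ hM hS).aemeasurable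
    (ae_of_all _ fun ω => measure_lt_top _ _)]
  rfl

/-- Multivariate Breiman lemma: the tail of `M Z`, measured against the tail of `‖Z‖`. -/
theorem IsMRV.tendsto_matApply (h : IsMRV P Z α (fun S => μ S)) (hZ : Measurable Z)
    (hM : Measurable M) (hindep : IndepFun M Z P) (hα : 0 < α) {γ : ℝ} (hγ : α < γ)
    (hint : Integrable (fun ω => ‖M ω‖ ^ γ) P) {S : Set (Fin q → ℝ)} (hS : MeasurableSet S)
    (hb : BddAwayFromZero S) (hfr : mixMeasure P M μ (frontier S) = 0) :
    Tendsto (fun t : ℝ => P.real {ω | matApply (M ω) (Z ω) ∈ t • S} / P.real {ω | t < ‖Z ω‖})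
      atTop (nhds (mixMeasure P M μ S).toReal) := by
  have := sigmaFinite_restrict_compl_zero h.2.1
  have hpre : ∀ m : Fin q → Fin d → ℝ, MeasurableSet (matApply m ⁻¹' S) := fun m =>
    (continuous_matApply_right m).measurable hS
  rw [mixMeasure_apply hM isClosed_frontier.measurableSet hb.frontier, lintegral_eq_zero_iff
    (measurable_measure_preimage_matApply hM isClosed_frontier.measurableSet hb.frontier)] at hfr
  rw [mixMeasure_apply hM hS hb, ← integral_toReal
    (measurable_measure_preimage_matApply hM hS hb).aemeasurable
    (ae_of_all _ fun ω => h.2.1 _ (hpre _) (hb.preimage_matApply _))]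
  obtain ⟨C, t₀, hC, ht₀, hpot⟩ := h.exists_potter_bound hα hγ
  obtain ⟨ε, hε, hSε⟩ := id hb
  have hlim : Tendsto (fun t : ℝ =>
      ∫ ω, P.real {ω' | Z ω' ∈ t • matApply (M ω) ⁻¹' S} / P.real {ω' | t < ‖Z ω'‖} ∂P) atTop
      (nhds (∫ ω, (μ (matApply (M ω) ⁻¹' S)).toReal ∂P)) := by
    refine tendsto_integral_filter_of_dominated_convergence
      (fun ω => 1 + C * (2 * (d * ‖M ω‖ + 1) / ε) ^ γ) ?_ ?_
      ((integrable_const 1).add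
        ((integrable_rpow_affine_norm hM (hα.trans hγ) hint hε).const_mul C)) ?_
    · filter_upwards [eventually_gt_atTop 0] with t ht
      simp_rw [← preimage_matApply_smul _ ht]
      exact ((measurable_measure_mem_preimage_matApply hZ hM
        (hS.const_smul₀ t)).ennreal_toReal.div_const _).aestronglyMeasurable
    · filter_upwards [eventually_ge_atTop t₀] with t ht
      refine ae_of_all _ fun ω => ?_
      have ht' : 0 < t := ht₀.trans_le ht
      rw [Real.norm_of_nonneg (div_nonneg measureReal_nonneg measureReal_nonneg)]
      refine le_trans ?_ (hpot t ht (2 * (d * ‖M ω‖ + 1) / ε) (by positivity))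
      refine div_le_div_of_nonneg_right (measureReal_mono fun ω' hω' => ?_) measureReal_nonneg
      have := smul_set_mono (a := t) (preimage_matApply_subset (M ω) hε hSε) hω'
      rwa [smul_setOf_lt_norm ht', mul_one_div] at this
    · filter_upwards [hfr] with ω hω
      refine h.2.2.1 _ (hpre _) (hb.preimage_matApply _) (measure_mono_null ?_ hω)
      exact (continuous_matApply_right _).frontier_preimage_subset S
  refine hlim.congr' ?_
  filter_upwards [eventually_gt_atTop 0] with t ht
  rw [measureReal_matApply_mem_eq_integral hZ hM hindep (hS.const_smul₀ t), integral_div]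
  simp_rw [preimage_matApply_smul _ ht]

end Mixing

/-- Proposition `Proposition_regular_mixing` (multivariate Breiman): if
`Z ∈ MRV(α, μ)` and `M` is an independent random matrix with `E[‖M‖^γ] < ∞` for some
`γ > α`, and `μ̃(B₁ᶜ) > 0` where `μ̃ = E[μ ∘ M⁻¹]`, then
`M·Z ∈ MRV(α, μ̃/μ̃(B₁ᶜ))`; in particular the normalized tail ratios converge. -/
theorem regular_variation_mixing {Ω : Type*} [MeasurableSpace Ω] (P : Measure Ω)
    [IsProbabilityMeasure P] {q d : ℕ}
    (Z : Ω → Fin d → ℝ) (M : Ω → Fin q → Fin d → ℝ)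
    (hZ : Measurable Z) (hM : Measurable M)
    (α : ℝ) (hα : 0 < α) (μ : Measure (Fin d → ℝ))
    (hZrv : IsMRV P Z α (fun S => μ S))
    (hindep : IndepFun M Z P)
    (hmom : ∃ γ > α, Integrable (fun ω => ‖M ω‖ ^ γ) P)
    (hpos : (∫⁻ ω, μ {x | matApply (M ω) x ∈ {y : Fin q → ℝ | 1 < ‖y‖}} ∂P) ≠ 0) :
    IsMRV P (fun ω => matApply (M ω) (Z ω)) α
      (fun S => (∫⁻ ω, μ {x | matApply (M ω) x ∈ S} ∂P)
        / (∫⁻ ω, μ {x | matApply (M ω) x ∈ {y : Fin q → ℝ | 1 < ‖y‖}} ∂P)) ∧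
    (∀ S : Set (Fin q → ℝ), MeasurableSet S → BddAwayFromZero S →
      ((∫⁻ ω, μ {x | matApply (M ω) x ∈ frontier S} ∂P)
        / (∫⁻ ω, μ {x | matApply (M ω) x ∈ {y : Fin q → ℝ | 1 < ‖y‖}} ∂P) = 0) →
      Tendsto (fun t : ℝ =>
          (P {ω | matApply (M ω) (Z ω) ∈ t • S}).toReal
            / (P {ω | t < ‖matApply (M ω) (Z ω)‖}).toReal)
        atTop (nhds ((∫⁻ ω, μ {x | matApply (M ω) x ∈ S} ∂P)
          / (∫⁻ ω, μ {x | matApply (M ω) x ∈ {y : Fin q → ℝ | 1 < ‖y‖}} ∂P)).toReal)) := by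
  obtain ⟨γ, hγ, hint⟩ := hmom
  have := sigmaFinite_restrict_compl_zero hZrv.2.1
  set U : Set (Fin q → ℝ) := {y | 1 < ‖y‖} with hU
  have hUm : MeasurableSet U := measurableSet_lt_norm 1
  have hUb : BddAwayFromZero U := bddAwayFromZero_lt_norm one_pos
  have hfin : ∀ S : Set (Fin q → ℝ), MeasurableSet S → BddAwayFromZero S →
      mixMeasure P M μ S < ⊤ := fun S => hZrv.mixMeasure_lt_top hM hα hγ hint
  have hhom : ∀ t : ℝ, 0 < t → ∀ S : Set (Fin q → ℝ), MeasurableSet S → BddAwayFromZero S →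
      mixMeasure P M μ (t • S) = ENNReal.ofReal (t ^ (-α)) * mixMeasure P M μ S :=
    fun t ht S => hZrv.mixMeasure_smul hM ht
  have happ : ∀ S : Set (Fin q → ℝ), MeasurableSet S → BddAwayFromZero S →
      ∫⁻ ω, μ {x | matApply (M ω) x ∈ S} ∂P = mixMeasure P M μ S :=
    fun S hS hb => (mixMeasure_apply hM hS hb).symm
  rw [happ U hUm hUb] at hpos ⊢
  have hUtop := (hfin U hUm hUb).ne
  have hUlim := hZrv.tendsto_matApply hZ hM hindep hα hγ hint hUm hUb
    (measure_frontier_lt_norm hfin hhom one_pos)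
  have hmain : ∀ S : Set (Fin q → ℝ), MeasurableSet S → BddAwayFromZero S →
      (∫⁻ ω, μ {x | matApply (M ω) x ∈ frontier S} ∂P) / mixMeasure P M μ U = 0 →
      Tendsto (fun t : ℝ => (P {ω | matApply (M ω) (Z ω) ∈ t • S}).toReal
          / (P {ω | t < ‖matApply (M ω) (Z ω)‖}).toReal)
        atTop (nhds ((∫⁻ ω, μ {x | matApply (M ω) x ∈ S} ∂P) / mixMeasure P M μ U).toReal) := by
    intro S hS hb hfr
    rw [happ _ isClosed_frontier.measurableSet hb.frontier,
      ENNReal.div_eq_zero_iff, or_iff_left hUtop] at hfr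
    rw [happ S hS hb, ENNReal.toReal_div]
    refine ((hZrv.tendsto_matApply hZ hM hindep hα hγ hint hS hb hfr).div hUlim
      (ENNReal.toReal_ne_zero.2 ⟨hpos, hUtop⟩)).congr' ?_
    filter_upwards [eventually_gt_atTop 0] with t ht
    rw [Pi.div_apply, div_div_div_cancel_right₀ (hZrv.tail_pos t).ne', hU,
      setOf_mem_smul_lt_norm ht, mul_one]
    rfl
  refine ⟨⟨⟨U, hUm, hUb, ?_⟩, fun S hS hb => ?_, hmain, fun t ht S hS hb => ?_⟩, hmain⟩
  · beta_reduce
    rw [happ U hUm hUb, ENNReal.div_self hpos hUtop]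
    exact one_ne_zero
  · beta_reduce
    rw [happ S hS hb]
    exact ENNReal.div_lt_top (hfin S hS hb).ne hpos
  · beta_reduce
    rw [happ S hS hb,
      happ _ (hS.const_smul₀ t) (hb.smul ht), hhom t ht S hS hb, mul_div_assoc]
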